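/- For the one-sided full β-shift with Bernoulli measure of weights p₀, …, p_{β−1}, for each n ∈ ℤ_{≥0} there exists a unique monic polynomial Φ_n of degree n in h that is an eigenvector of V_S with eigenvalue Σ_{i∈[β]} p_i^{n+1}; the eigenvalues of V_S restricted to the space ℂ[h] of polynomials in h are exactly {Σ_{i∈[β]} p_i^{n+1} : n ≥ 0}, each with one-dimensional eigenspace in ℂ[h]. -/

import Mathlib

open MeasureTheory Filter
open scoped ENNReal

noncomputable section

/-- The left shift `(Sω)_j = ω_{j+1}` on `Σ₊ = [β]^ℕ` (index `n` corresponds to `ω_{n+1}`). -/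
def shiftB {β : ℕ} (ω : ℕ → Fin β) : ℕ → Fin β := fun n => ω (n + 1)

/-- `μ` is the Bernoulli product measure with weights `p`. -/
def IsBernoulli {β : ℕ} (p : Fin β → ℝ) (μ : Measure (ℕ → Fin β)) : Prop :=
  ∀ (n : ℕ) (x : Fin n → Fin β),
    μ {ω | ∀ i : Fin n, ω i = x i} = ∏ i : Fin n, ENNReal.ofReal (p (x i))

/-- `N_n^k(ω) = #{i ∈ {1,…,n−1} : ω_i = k}` (0-indexed: positions `0, …, n−2`). -/
def NCount {β : ℕ} (n : ℕ) (k : Fin β) (ω : ℕ → Fin β) : ℕ :=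
  ((Finset.range n).filter fun i => ω i = k).card

/-- `h(ω) = ∑_{n≥1, ω_n ≠ 0} (p₀ + ⋯ + p_{ω_n − 1}) ∏_k p_k^{N_n^k(ω)}`. -/
def hB {β : ℕ} (p : Fin β → ℝ) (ω : ℕ → Fin β) : ℝ :=
  ∑' j : ℕ, (∑ l : Fin β, if (l : ℕ) < (ω j : ℕ) then p l else 0) *
    ∏ k : Fin β, p k ^ NCount j k ω

open Polynomial in
/-- A nonzero eigenvector of a triangular operator on polynomials has the diagonal entry at its
degree as eigenvalue. -/
theorem eigenvalue_eq_of_triangular {K : Type*} [Field K] {T : K[X] →ₗ[K] K[X]} {lam : ℕ → K}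
    (hT : ∀ n, ∀ q ∈ degreeLT K (n + 1), T q - lam n • q ∈ degreeLT K n)
    {q : K[X]} (hq : q ≠ 0) {z : K} (hz : T q = z • q) : z = lam q.natDegree := by
  have h := hT q.natDegree q
    (mem_degreeLT.2 (degree_le_natDegree.trans_lt (by exact_mod_cast Nat.lt_succ_self _)))
  rw [hz, ← sub_smul, mem_degreeLT] at h
  have h0 := coeff_eq_zero_of_degree_lt h
  rw [coeff_smul, smul_eq_mul, coeff_natDegree] at h0
  exact sub_eq_zero.1 ((mul_eq_zero.1 h0).resolve_right (leadingCoeff_ne_zero.2 hq))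

open Polynomial in
theorem exists_monic_eigenvector_of_triangular {K : Type*} [Field K] {T : K[X] →ₗ[K] K[X]}
    {lam : ℕ → K} (hlam : Function.Injective lam)
    (hT : ∀ n, ∀ q ∈ degreeLT K (n + 1), T q - lam n • q ∈ degreeLT K n) (n : ℕ) :
    ∃ q : K[X], q.Monic ∧ q.natDegree = n ∧ T q = lam n • q := by
  let L : degreeLT K (n + 1) →ₗ[K] degreeLT K n :=
    ((T - lam n • LinearMap.id).comp (degreeLT K (n + 1)).subtype).codRestrict _
      fun q => hT n q q.2
  have (m : ℕ) : FiniteDimensional K (degreeLT K m) :=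
    (degreeLTEquiv K m).symm.finiteDimensional
  have hker : LinearMap.ker L ≠ ⊥ := by
    apply LinearMap.ker_ne_bot_of_finrank_lt
    rw [(degreeLTEquiv K n).finrank_eq, (degreeLTEquiv K (n + 1)).finrank_eq]
    simp
  obtain ⟨⟨q, hqm⟩, hqL, hq0⟩ := Submodule.exists_mem_ne_zero_of_ne_bot hker
  have hq : q ≠ 0 := fun h => hq0 (Subtype.ext h)
  have hTq : T q = lam n • q := sub_eq_zero.1 (congrArg Subtype.val (LinearMap.mem_ker.1 hqL))
  have hdeg : q.natDegree = n := (hlam (eigenvalue_eq_of_triangular hT hq hTq)).symm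
  refine ⟨C q.leadingCoeff⁻¹ * q, ?_, ?_, ?_⟩
  · rw [mul_comm]; exact monic_mul_leadingCoeff_inv hq
  · rw [natDegree_C_mul (inv_ne_zero (leadingCoeff_ne_zero.2 hq)), hdeg]
  · rw [← smul_eq_C_mul, map_smul, hTq, smul_comm]

open Polynomial in
theorem eigenvector_unique_of_triangular {K : Type*} [Field K] {T : K[X] →ₗ[K] K[X]}
    {lam : ℕ → K} (hlam : Function.Injective lam)
    (hT : ∀ n, ∀ q ∈ degreeLT K (n + 1), T q - lam n • q ∈ degreeLT K n) {n : ℕ}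
    {q r : K[X]} (hq : q ≠ 0) (hTq : T q = lam n • q) (hTr : T r = lam n • r) :
    r = (r.coeff n / q.leadingCoeff) • q := by
  have hdeg : q.natDegree = n := (hlam (eigenvalue_eq_of_triangular hT hq hTq)).symm
  by_contra hne
  have h0 : r - (r.coeff n / q.leadingCoeff) • q ≠ 0 := sub_ne_zero.2 hne
  have hT0 : T (r - (r.coeff n / q.leadingCoeff) • q) =
      lam n • (r - (r.coeff n / q.leadingCoeff) • q) := by
    rw [map_sub, map_smul, hTq, hTr, smul_sub, smul_comm]
  have hd := hlam (eigenvalue_eq_of_triangular hT h0 hT0)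
  apply leadingCoeff_ne_zero.2 h0
  rw [leadingCoeff, ← hd, coeff_sub, coeff_smul, smul_eq_mul]
  have : q.coeff n = q.leadingCoeff := by rw [leadingCoeff, hdeg]
  rw [this, div_mul_cancel₀ _ (leadingCoeff_ne_zero.2 hq), sub_self]

open Polynomial in
theorem coeff_comp_linear {K : Type*} [Field K] (c : K) {a : K} (ha : a ≠ 0) {q : K[X]} {n : ℕ}
    (hq : q.natDegree ≤ n) : (q.comp (C a * X + C c)).coeff n = a ^ n * q.coeff n := by
  have hl := natDegree_linear (b := c) ha
  have hnd : (q.comp (C a * X + C c)).natDegree = q.natDegree := by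
    rw [natDegree_comp, hl, mul_one]
  rcases hq.eq_or_lt with h | h
  · have := coeff_comp_degree_mul_degree (p := q) (q := C a * X + C c) (by rw [hl]; simp)
    rw [hl, mul_one, leadingCoeff_linear ha, h] at this
    rw [this, leadingCoeff, h, mul_comm]
  · rw [coeff_eq_zero_of_natDegree_lt (hnd.trans_lt h), coeff_eq_zero_of_natDegree_lt h, mul_zero]

/-- The sum of the weights of the letters strictly below `i`. -/
def lowerWeight {β : ℕ} (p : Fin β → ℝ) (i : Fin β) : ℝ :=
  ∑ l : Fin β, if (l : ℕ) < (i : ℕ) then p l else 0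

open Polynomial in
/-- The action of the Perron–Frobenius operator on polynomials in `hB p`. -/
def transferPoly {β : ℕ} (p : Fin β → ℝ) : ℂ[X] →ₗ[ℂ] ℂ[X] where
  toFun q := ∑ i, (p i : ℂ) • q.comp (C (p i : ℂ) * X + C (lowerWeight p i : ℂ))
  map_add' q r := by simp only [add_comp, smul_add, Finset.sum_add_distrib]
  map_smul' a q := by
    simp only [smul_comp, RingHom.id_apply, Finset.smul_sum]
    exact Finset.sum_congr rfl fun i _ => smul_comm _ _ _

open Polynomial in
theorem transferPoly_triangular {β : ℕ} {p : Fin β → ℝ} (hp : ∀ i, 0 < p i) (n : ℕ) (q : ℂ[X])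
    (hq : q ∈ degreeLT ℂ (n + 1)) :
    transferPoly p q - (∑ i, (p i : ℂ) ^ (n + 1)) • q ∈ degreeLT ℂ n := by
  have hpc (i : Fin β) : (p i : ℂ) ≠ 0 := by exact_mod_cast (hp i).ne'
  have key (m : ℕ) (hm : q.natDegree ≤ m) : (transferPoly p q).coeff m =
      (∑ i, (p i : ℂ) ^ (m + 1)) * q.coeff m := by
    simp only [transferPoly, LinearMap.coe_mk, AddHom.coe_mk, finsetSum_coeff, coeff_smul,
      smul_eq_mul, Finset.sum_mul]
    refine Finset.sum_congr rfl fun i _ => ?_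
    rw [coeff_comp_linear _ (hpc i) hm]
    ring
  have hqn : q.natDegree ≤ n := natDegree_le_iff_degree_le.2
    (degree_le_iff_coeff_zero _ _ |>.2 fun m hm => coeff_eq_zero_of_degree_lt
      ((mem_degreeLT.1 hq).trans_le (by exact_mod_cast hm)))
  rw [mem_degreeLT, degree_lt_iff_coeff_zero]
  intro m hm
  rw [coeff_sub, coeff_smul, smul_eq_mul, key m (hqn.trans hm)]
  rcases hm.eq_or_lt with rfl | h
  · exact sub_self _
  · rw [coeff_eq_zero_of_natDegree_lt (hqn.trans_lt h), mul_zero, mul_zero, sub_zero]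

/-- Prepend the letter `i` to the sequence `ω`. -/
def consB {β : ℕ} (i : Fin β) (ω : ℕ → Fin β) : ℕ → Fin β
  | 0 => i
  | n + 1 => ω n

theorem measurable_consB {β : ℕ} (i : Fin β) : Measurable (consB i) := by
  refine measurable_pi_lambda _ fun n => ?_
  cases n with
  | zero => exact measurable_const
  | succ n => exact measurable_pi_apply n

theorem shiftB_consB {β : ℕ} (i : Fin β) (ω : ℕ → Fin β) : shiftB (consB i ω) = ω := rfl

theorem isPiSystem_cylinders (β : ℕ) :
    IsPiSystem {s : Set (ℕ → Fin β) | ∃ (n : ℕ) (x : Fin n → Fin β),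
      s = {ω | ∀ i : Fin n, ω i = x i}} := by
  have aux {n m : ℕ} (hnm : n ≤ m) (x : Fin n → Fin β) (y : Fin m → Fin β)
      (hne : ({ω : ℕ → Fin β | ∀ i : Fin n, ω i = x i} ∩
        {ω | ∀ i : Fin m, ω i = y i}).Nonempty) :
      {ω : ℕ → Fin β | ∀ i : Fin m, ω i = y i} ⊆ {ω | ∀ i : Fin n, ω i = x i} := by
    obtain ⟨ω, hx, hy⟩ := hne
    intro η hη i
    exact (hη (Fin.castLE hnm i)).trans ((hy (Fin.castLE hnm i)).symm.trans (hx i))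
  rintro _ ⟨n, x, rfl⟩ _ ⟨m, y, rfl⟩ hne
  rcases le_total n m with h | h
  · exact ⟨m, y, Set.inter_eq_right.2 (aux h x y hne)⟩
  · exact ⟨n, x, Set.inter_eq_left.2 (aux h y x (Set.inter_comm _ _ ▸ hne))⟩

theorem generateFrom_cylinders (β : ℕ) :
    (MeasurableSpace.pi : MeasurableSpace (ℕ → Fin β)) =
      MeasurableSpace.generateFrom {s | ∃ (n : ℕ) (x : Fin n → Fin β),
        s = {ω | ∀ i : Fin n, ω i = x i}} := by
  apply le_antisymm
  · refine iSup_le fun k => ?_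
    rw [← measurable_iff_comap_le]
    refine @measurable_to_countable' _ _ _ _ (MeasurableSpace.generateFrom _) _ fun a => ?_
    have : (fun ω : ℕ → Fin β => ω k) ⁻¹' {a} =
        ⋃ x ∈ {x : Fin (k + 1) → Fin β | x (Fin.last k) = a},
          {ω : ℕ → Fin β | ∀ i : Fin (k + 1), ω i = x i} := by
      ext ω
      simp only [Set.mem_preimage, Set.mem_singleton_iff, Set.mem_iUnion, Set.mem_ofPred_eq,
        exists_prop]
      constructor
      · intro h
        exact ⟨fun i => ω i, h, fun _ => rfl⟩
      · rintro ⟨x, hx, h⟩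
        rw [← hx]
        exact h (Fin.last k)
    rw [this]
    exact MeasurableSet.biUnion (Set.to_countable _) fun x _ =>
      MeasurableSpace.measurableSet_generateFrom ⟨_, x, rfl⟩
  · refine MeasurableSpace.generateFrom_le ?_
    rintro _ ⟨n, x, rfl⟩
    rw [Set.ofPred_forall]
    exact MeasurableSet.iInter fun i =>
      measurableSet_eq_fun (measurable_pi_apply (i : ℕ)) measurable_const

theorem IsBernoulli.unique {β : ℕ} {p : Fin β → ℝ} {μ ν : Measure (ℕ → Fin β)}
    [IsFiniteMeasure μ] (hμ : IsBernoulli p μ) (hν : IsBernoulli p ν) : μ = ν := by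
  refine ext_of_generate_finite _ (generateFrom_cylinders β) (isPiSystem_cylinders β) ?_ ?_
  · rintro _ ⟨n, x, rfl⟩
    rw [hμ, hν]
  · have h1 := hμ 0 Fin.elim0
    have h2 := hν 0 Fin.elim0
    simp only [IsEmpty.forall_iff, Set.ofPred_true] at h1 h2
    rw [h1, h2]

theorem IsBernoulli.eq_sum_map_consB {β : ℕ} {p : Fin β → ℝ} (hp : ∀ i, 0 < p i)
    (hpsum : ∑ i, p i = 1) {μ : Measure (ℕ → Fin β)} [IsProbabilityMeasure μ]
    (hμ : IsBernoulli p μ) :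
    μ = ∑ i, ENNReal.ofReal (p i) • μ.map (consB i) := by
  refine hμ.unique fun n x => ?_
  have hms (n : ℕ) (x : Fin n → Fin β) :
      MeasurableSet {ω : ℕ → Fin β | ∀ i : Fin n, ω i = x i} := by
    rw [generateFrom_cylinders]
    exact MeasurableSpace.measurableSet_generateFrom ⟨n, x, rfl⟩
  simp only [Measure.coe_finsetSum, Finset.sum_apply, Measure.smul_apply, smul_eq_mul,
    Measure.map_apply (measurable_consB _) (hms n x)]
  cases n with
  | zero =>
    simp [← ENNReal.ofReal_sum_of_nonneg fun i _ => (hp i).le, hpsum]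
  | succ n =>
    rw [Finset.sum_eq_single (x 0), Fin.prod_univ_succ]
    · congr 1
      rw [← hμ n fun i => x i.succ]
      congr 1
      ext ω
      simp [Fin.forall_fin_succ, consB]
    · intro i _ hi
      have : consB i ⁻¹' {ω : ℕ → Fin β | ∀ j : Fin (n + 1), ω j = x j} = ∅ := by
        ext ω
        simp only [Set.mem_preimage, Set.mem_ofPred_eq, Set.mem_empty_iff_false, iff_false]
        exact fun h => hi (h 0)
      rw [this, measure_empty, mul_zero]
    · simp

theorem IsBernoulli.quasiMeasurePreserving_consB {β : ℕ} {p : Fin β → ℝ} (hp : ∀ i, 0 < p i)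
    (hpsum : ∑ i, p i = 1) {μ : Measure (ℕ → Fin β)} [IsProbabilityMeasure μ]
    (hμ : IsBernoulli p μ) (i : Fin β) : Measure.QuasiMeasurePreserving (consB i) μ μ := by
  refine ⟨measurable_consB i, Measure.AbsolutelyContinuous.mk fun s _ h => ?_⟩
  rw [hμ.eq_sum_map_consB hp hpsum] at h
  simp only [Measure.coe_finsetSum, Finset.sum_apply, Measure.smul_apply, smul_eq_mul,
    Finset.sum_eq_zero_iff, Finset.mem_univ, true_imp_iff, mul_eq_zero] at h
  exact (h i).resolve_left (ENNReal.ofReal_pos.2 (hp i)).ne'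

theorem IsBernoulli.integral_eq_sum {β : ℕ} {p : Fin β → ℝ} (hp : ∀ i, 0 < p i)
    (hpsum : ∑ i, p i = 1) {μ : Measure (ℕ → Fin β)} [IsProbabilityMeasure μ]
    (hμ : IsBernoulli p μ) {G : (ℕ → Fin β) → ℂ} (hG : Integrable G μ) :
    (∀ i, Integrable (fun ω => G (consB i ω)) μ) ∧
      ∫ ω, G ω ∂μ = ∑ i, (p i : ℂ) * ∫ ω, G (consB i ω) ∂μ := by
  have hG' := hG
  rw [hμ.eq_sum_map_consB hp hpsum, integrable_finsetSum_measure] at hG'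
  have hmap (i : Fin β) : Integrable G (μ.map (consB i)) :=
    (integrable_smul_measure (ENNReal.ofReal_pos.2 (hp i)).ne' ENNReal.ofReal_ne_top).1
      (hG' i (Finset.mem_univ i))
  refine ⟨fun i => (hmap i).comp_measurable (measurable_consB i), ?_⟩
  conv_lhs => rw [hμ.eq_sum_map_consB hp hpsum]
  rw [integral_finsetSum_measure hG']
  refine Finset.sum_congr rfl fun i _ => ?_
  rw [integral_smul_measure, integral_map (measurable_consB i).aemeasurable
    (hmap i).aestronglyMeasurable, ENNReal.toReal_ofReal (hp i).le, Complex.real_smul]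

theorem hB_eq_tsum {β : ℕ} (p : Fin β → ℝ) (ω : ℕ → Fin β) :
    hB p ω = ∑' j : ℕ, lowerWeight p (ω j) * ∏ i ∈ Finset.range j, p (ω i) := by
  refine tsum_congr fun j => ?_
  rw [lowerWeight, ← Finset.prod_fiberwise (Finset.range j) ω]
  congr 1
  refine Finset.prod_congr rfl fun k _ => ?_
  rw [NCount, ← Finset.prod_const]
  exact Finset.prod_congr rfl fun i hi => by rw [(Finset.mem_filter.1 hi).2]

section Weights

variable {β : ℕ} {p : Fin β → ℝ}

theorem lowerWeight_nonneg (hp : ∀ i, 0 < p i) (i : Fin β) : 0 ≤ lowerWeight p i :=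
  Finset.sum_nonneg fun l _ => by split_ifs <;> simp [(hp l).le]

theorem lowerWeight_add_le_one (hp : ∀ i, 0 < p i) (hpsum : ∑ i, p i = 1) (i : Fin β) :
    lowerWeight p i + p i ≤ 1 := by
  have : p i = ∑ l, if l = i then p l else 0 := by simp
  rw [lowerWeight, this, ← Finset.sum_add_distrib, ← hpsum]
  refine Finset.sum_le_sum fun l _ => ?_
  have := (hp l).le
  by_cases h : l = i
  · subst h; simp
  · split_ifs <;> simp [this]

theorem hB_term_nonneg (hp : ∀ i, 0 < p i) (ω : ℕ → Fin β) (j : ℕ) :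
    0 ≤ lowerWeight p (ω j) * ∏ i ∈ Finset.range j, p (ω i) :=
  mul_nonneg (lowerWeight_nonneg hp _) (Finset.prod_nonneg fun _ _ => (hp _).le)

theorem hB_sum_range_le_one (hp : ∀ i, 0 < p i) (hpsum : ∑ i, p i = 1) (ω : ℕ → Fin β) (n : ℕ) :
    ∑ j ∈ Finset.range n, lowerWeight p (ω j) * ∏ i ∈ Finset.range j, p (ω i) ≤ 1 := by
  have key : ∑ j ∈ Finset.range n, lowerWeight p (ω j) * ∏ i ∈ Finset.range j, p (ω i) +
      ∏ i ∈ Finset.range n, p (ω i) ≤ 1 := by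
    induction n with
    | zero => simp
    | succ n ih =>
      rw [Finset.sum_range_succ, Finset.prod_range_succ]
      have h0 : 0 ≤ ∏ i ∈ Finset.range n, p (ω i) := Finset.prod_nonneg fun _ _ => (hp _).le
      nlinarith [mul_le_mul_of_nonneg_right (lowerWeight_add_le_one hp hpsum (ω n)) h0]
  exact (le_add_of_nonneg_right (Finset.prod_nonneg fun _ _ => (hp _).le)).trans key

theorem summable_hB (hp : ∀ i, 0 < p i) (hpsum : ∑ i, p i = 1) (ω : ℕ → Fin β) :
    Summable fun j => lowerWeight p (ω j) * ∏ i ∈ Finset.range j, p (ω i) :=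
  summable_of_sum_range_le (hB_term_nonneg hp ω) (hB_sum_range_le_one hp hpsum ω)

theorem hB_nonneg (hp : ∀ i, 0 < p i) (ω : ℕ → Fin β) : 0 ≤ hB p ω := by
  rw [hB_eq_tsum]
  exact tsum_nonneg (hB_term_nonneg hp ω)

theorem hB_le_one (hp : ∀ i, 0 < p i) (hpsum : ∑ i, p i = 1) (ω : ℕ → Fin β) : hB p ω ≤ 1 := by
  rw [hB_eq_tsum]
  exact Real.tsum_le_of_sum_range_le (hB_term_nonneg hp ω) (hB_sum_range_le_one hp hpsum ω)

theorem measurable_hB (hp : ∀ i, 0 < p i) (hpsum : ∑ i, p i = 1) : Measurable (hB p) := by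
  have hterm (j : ℕ) : Measurable fun ω : ℕ → Fin β =>
      lowerWeight p (ω j) * ∏ i ∈ Finset.range j, p (ω i) := by
    refine Measurable.mul ((measurable_of_finite (lowerWeight p)).comp (measurable_pi_apply j)) ?_
    exact Finset.measurable_prod _ fun i _ =>
      (measurable_of_finite p).comp (measurable_pi_apply i)
  refine measurable_of_tendsto_metrizable
    (f := fun n ω => ∑ j ∈ Finset.range n, lowerWeight p (ω j) * ∏ i ∈ Finset.range j, p (ω i))
    (fun n => Finset.measurable_sum (Finset.range n) fun j _ => hterm j) ?_
  rw [tendsto_pi_nhds]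
  intro ω
  rw [hB_eq_tsum]
  simpa using (summable_hB hp hpsum ω).hasSum.tendsto_sum_nat

theorem hB_consB (hp : ∀ i, 0 < p i) (hpsum : ∑ i, p i = 1) (i : Fin β) (ω : ℕ → Fin β) :
    hB p (consB i ω) = p i * hB p ω + lowerWeight p i := by
  rw [hB_eq_tsum, (summable_hB hp hpsum _).tsum_eq_zero_add, hB_eq_tsum, ← tsum_mul_left, add_comm]
  congr 1
  · refine tsum_congr fun j => ?_
    rw [Finset.prod_range_succ']
    simp only [consB]
    ring
  · simp [consB]

theorem memLp_eval_hB (hp : ∀ i, 0 < p i) (hpsum : ∑ i, p i = 1) (μ : Measure (ℕ → Fin β))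
    [IsFiniteMeasure μ] (q : Polynomial ℂ) :
    MemLp (fun ω => q.eval (hB p ω : ℂ)) 2 μ := by
  obtain ⟨B, hB'⟩ := (isCompact_Icc (a := (0 : ℝ)) (b := 1)).exists_bound_of_continuousOn
    (f := fun x : ℝ => q.eval (x : ℂ)) (by fun_prop)
  refine MemLp.of_bound (C := B) ?_ (ae_of_all _ fun ω =>
    hB' _ ⟨hB_nonneg hp ω, hB_le_one hp hpsum ω⟩)
  exact (q.continuous.measurable.comp
    (Complex.measurable_ofReal.comp (measurable_hB hp hpsum))).aestronglyMeasurable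

theorem IsBernoulli.polynomial_eq_zero (hβ : 2 ≤ β) (hp : ∀ i, 0 < p i) (hpsum : ∑ i, p i = 1)
    {μ : Measure (ℕ → Fin β)} [IsProbabilityMeasure μ] (hμ : IsBernoulli p μ) {q : Polynomial ℂ}
    (hq : ∀ᵐ ω ∂μ, q.eval (hB p ω : ℂ) = 0) : q = 0 := by
  let a : Fin β := ⟨0, by omega⟩
  let b : Fin β := ⟨1, by omega⟩
  have hab : a ≠ b := by simp [a, b]
  have hca : lowerWeight p a = 0 := by simp [lowerWeight, a]
  have hcb : 0 < lowerWeight p b := by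
    refine Finset.sum_pos' (fun l _ => ?_) ⟨a, Finset.mem_univ a, ?_⟩
    · split_ifs <;> simp [(hp l).le]
    · simp [a, b, hp]
  have hpa : p a < 1 := by
    have h := lowerWeight_add_le_one hp hpsum b
    have h1 : p a ≤ lowerWeight p b := by
      have := Finset.single_le_sum (f := fun l : Fin β => if (l : ℕ) < (b : ℕ) then p l else 0)
        (fun l _ => by split_ifs <;> simp [(hp l).le]) (Finset.mem_univ a)
      simpa [a, b, lowerWeight] using this
    linarith [hp b]
  have hroot (n : ℕ) : ∀ᵐ ω ∂μ,
      q.eval ((p a ^ n * (p b * hB p ω + lowerWeight p b) : ℝ) : ℂ) = 0 := by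
    have hiter : ∀ᵐ ω ∂μ, q.eval ((p a ^ n * hB p ω : ℝ) : ℂ) = 0 := by
      induction n with
      | zero => simpa using hq
      | succ n ih =>
        filter_upwards [(hμ.quasiMeasurePreserving_consB hp hpsum a).ae ih] with ω hω
        rwa [hB_consB hp hpsum, hca, add_zero, ← mul_assoc, ← pow_succ] at hω
    filter_upwards [(hμ.quasiMeasurePreserving_consB hp hpsum b).ae hiter] with ω hω
    rwa [hB_consB hp hpsum] at hω
  obtain ⟨ω, hω⟩ := (ae_all_iff.2 hroot).exists
  have hx : 0 < p b * hB p ω + lowerWeight p b :=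
    add_pos_of_nonneg_of_pos (mul_nonneg (hp b).le (hB_nonneg hp ω)) hcb
  refine Polynomial.eq_zero_of_infinite_isRoot q
    ((Set.infinite_range_of_injective ?_).mono (Set.range_subset_iff.2 hω))
  intro m n hmn
  exact pow_right_injective₀ (hp a) hpa.ne (mul_right_cancel₀ hx.ne' (Complex.ofReal_injective hmn))

theorem eval_transferPoly (hp : ∀ i, 0 < p i) (hpsum : ∑ i, p i = 1) (q : Polynomial ℂ)
    (ω : ℕ → Fin β) : (transferPoly p q).eval (hB p ω : ℂ) =
      ∑ i, (p i : ℂ) * q.eval (hB p (consB i ω) : ℂ) := by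
  simp [transferPoly, Polynomial.eval_finsetSum, hB_consB hp hpsum]

/-- The element of `L²` represented by a polynomial in `hB p`. -/
def polyLp (hp : ∀ i, 0 < p i) (hpsum : ∑ i, p i = 1) (μ : Measure (ℕ → Fin β))
    [IsFiniteMeasure μ] : Polynomial ℂ →ₗ[ℂ] Lp ℂ 2 μ where
  toFun q := (memLp_eval_hB hp hpsum μ q).toLp
  map_add' q r := by
    rw [← MemLp.toLp_add]
    congr 1
    ext ω
    simp
  map_smul' c q := by
    rw [RingHom.id_apply, ← MemLp.toLp_const_smul]
    congr 1
    ext ω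
    simp

theorem coeFn_polyLp (hp : ∀ i, 0 < p i) (hpsum : ∑ i, p i = 1) (μ : Measure (ℕ → Fin β))
    [IsFiniteMeasure μ] (q : Polynomial ℂ) :
    ⇑(polyLp hp hpsum μ q) =ᵐ[μ] fun ω => q.eval (hB p ω : ℂ) :=
  (memLp_eval_hB hp hpsum μ q).coeFn_toLp

theorem IsBernoulli.polyLp_injective (hβ : 2 ≤ β) (hp : ∀ i, 0 < p i) (hpsum : ∑ i, p i = 1)
    {μ : Measure (ℕ → Fin β)} [IsProbabilityMeasure μ] (hμ : IsBernoulli p μ) :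
    Function.Injective (polyLp hp hpsum μ) := by
  rw [injective_iff_map_eq_zero]
  intro q hq
  refine hμ.polynomial_eq_zero hβ hp hpsum ?_
  filter_upwards [coeFn_polyLp hp hpsum μ q, Lp.coeFn_zero ℂ 2 μ] with ω h1 h2
  rw [← h1, hq, h2, Pi.zero_apply]

theorem IsBernoulli.adjoint_polyLp (hp : ∀ i, 0 < p i) (hpsum : ∑ i, p i = 1)
    {μ : Measure (ℕ → Fin β)} [IsProbabilityMeasure μ] (hμ : IsBernoulli p μ)
    {U : Lp ℂ 2 μ →L[ℂ] Lp ℂ 2 μ} (hU : ∀ f : Lp ℂ 2 μ, ⇑(U f) =ᵐ[μ] fun ω => f (shiftB ω))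
    (q : Polynomial ℂ) :
    ContinuousLinearMap.adjoint U (polyLp hp hpsum μ q) =
      polyLp hp hpsum μ (transferPoly p q) := by
  refine ext_inner_right ℂ fun g => ?_
  rw [ContinuousLinearMap.adjoint_inner_left, L2.inner_def, L2.inner_def]
  have hae : (fun ω => inner ℂ (polyLp hp hpsum μ q ω) (U g ω)) =ᵐ[μ]
      fun ω => inner ℂ (q.eval (hB p ω : ℂ)) (g (shiftB ω)) := by
    filter_upwards [coeFn_polyLp hp hpsum μ q, hU g] with ω h1 h2
    rw [h1, h2]
  have hint := (integrable_congr hae).1 (L2.integrable_inner (𝕜 := ℂ) (polyLp hp hpsum μ q) (U g))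
  obtain ⟨hi, hsum⟩ := hμ.integral_eq_sum hp hpsum hint
  rw [integral_congr_ae hae, hsum]
  simp_rw [← integral_const_mul]
  rw [← integral_finsetSum _ fun i _ => (hi i).const_mul _]
  refine integral_congr_ae ?_
  filter_upwards [coeFn_polyLp hp hpsum μ (transferPoly p q)] with ω h
  rw [h, eval_transferPoly hp hpsum, sum_inner]
  refine Finset.sum_congr rfl fun i _ => ?_
  rw [shiftB_consB, ← smul_eq_mul (p i : ℂ) (q.eval _), inner_smul_left, Complex.conj_ofReal]

end Weights

/-- For each `n` there is a unique monic polynomial `Φ_n` of degree `n` in `h`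
which is an eigenvector of `V_S` with eigenvalue `∑_i p_i^{n+1}`; the eigenvalues of `V_S`
restricted to `ℂ[h]` are exactly `{∑_i p_i^{n+1} : n ≥ 0}`, each with a one-dimensional
eigenspace in `ℂ[h]`. -/
theorem stmt_15
    (β : ℕ) (hβ : 2 ≤ β) (p : Fin β → ℝ)
    (hp : ∀ i, 0 < p i) (hpsum : ∑ i : Fin β, p i = 1)
    (μ : Measure (ℕ → Fin β)) [IsProbabilityMeasure μ]
    (hμ : IsBernoulli p μ)
    (hS : MeasurePreserving (shiftB (β := β)) μ μ)
    (U V : Lp ℂ 2 μ →L[ℂ] Lp ℂ 2 μ)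
    (hU : ∀ f : Lp ℂ 2 μ, ⇑(U f) =ᵐ[μ] fun ω => f (shiftB ω))
    (hV : V = ContinuousLinearMap.adjoint U)
    (hdist : Function.Injective fun n : ℕ => ∑ i : Fin β, p i ^ (n + 1)) :
    (∀ n : ℕ, ∃! Φ : Lp ℂ 2 μ,
      (∃ q : Polynomial ℂ, q.Monic ∧ q.natDegree = n ∧
          ⇑Φ =ᵐ[μ] fun ω => q.eval (hB p ω : ℂ)) ∧
      V Φ = (∑ i : Fin β, (p i : ℂ) ^ (n + 1)) • Φ) ∧
    (∀ z : ℂ,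
      (∃ f : Lp ℂ 2 μ, (∃ q : Polynomial ℂ, ⇑f =ᵐ[μ] fun ω => q.eval (hB p ω : ℂ)) ∧
          f ≠ 0 ∧ V f = z • f) ↔
      (∃ n : ℕ, z = ∑ i : Fin β, (p i : ℂ) ^ (n + 1))) ∧
    (∀ n : ℕ, ∀ f g : Lp ℂ 2 μ,
      (∃ q : Polynomial ℂ, ⇑f =ᵐ[μ] fun ω => q.eval (hB p ω : ℂ)) → f ≠ 0 →
      V f = (∑ i : Fin β, (p i : ℂ) ^ (n + 1)) • f →
      (∃ q : Polynomial ℂ, ⇑g =ᵐ[μ] fun ω => q.eval (hB p ω : ℂ)) →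
      V g = (∑ i : Fin β, (p i : ℂ) ^ (n + 1)) • g →
      ∃ c : ℂ, g = c • f) := by
  have hT := transferPoly_triangular hp
  have hlam : Function.Injective fun n : ℕ => ∑ i : Fin β, (p i : ℂ) ^ (n + 1) := by
    intro m n hmn
    apply hdist
    simp only at hmn ⊢
    exact_mod_cast hmn
  have hinj := hμ.polyLp_injective hβ hp hpsum
  have hrep {f : Lp ℂ 2 μ} {q : Polynomial ℂ} (h : ⇑f =ᵐ[μ] fun ω => q.eval (hB p ω : ℂ)) :
      f = polyLp hp hpsum μ q := Lp.ext (h.trans (coeFn_polyLp hp hpsum μ q).symm)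
  have heig (q : Polynomial ℂ) (z : ℂ) :
      V (polyLp hp hpsum μ q) = z • polyLp hp hpsum μ q ↔ transferPoly p q = z • q := by
    rw [hV, hμ.adjoint_polyLp hp hpsum hU, ← map_smul, hinj.eq_iff]
  refine ⟨fun n => ?_, fun z => ⟨?_, ?_⟩, ?_⟩
  · obtain ⟨q, hq, hqn, hTq⟩ := exists_monic_eigenvector_of_triangular hlam hT n
    refine ⟨polyLp hp hpsum μ q, ⟨⟨q, hq, hqn, coeFn_polyLp hp hpsum μ q⟩, (heig _ _).2 hTq⟩, ?_⟩
    rintro Φ ⟨⟨r, hr, hrn, hΦ⟩, hVΦ⟩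
    rw [hrep hΦ] at hVΦ ⊢
    have h := eigenvector_unique_of_triangular hlam hT hq.ne_zero hTq ((heig _ _).1 hVΦ)
    rw [← hrn, Polynomial.coeff_natDegree, hr.leadingCoeff, hq.leadingCoeff, div_one,
      one_smul] at h
    rw [h]
  · rintro ⟨f, ⟨q, hf⟩, hf0, hVf⟩
    rw [hrep hf] at hf0 hVf
    exact ⟨q.natDegree, eigenvalue_eq_of_triangular hT
      (fun h => hf0 (by rw [h, map_zero])) ((heig _ _).1 hVf)⟩
  · rintro ⟨n, rfl⟩
    obtain ⟨q, hq, -, hTq⟩ := exists_monic_eigenvector_of_triangular hlam hT n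
    exact ⟨polyLp hp hpsum μ q, ⟨q, coeFn_polyLp hp hpsum μ q⟩,
      (map_ne_zero_iff _ hinj).2 hq.ne_zero, (heig _ _).2 hTq⟩
  · rintro n f g ⟨q, hf⟩ hf0 hVf ⟨r, hg⟩ hVg
    rw [hrep hf] at hf0 hVf ⊢
    rw [hrep hg] at hVg ⊢
    have h := eigenvector_unique_of_triangular hlam hT
      (fun h => hf0 (by rw [h, map_zero])) ((heig _ _).1 hVf) ((heig _ _).1 hVg)
    exact ⟨_, by rw [← map_smul, ← h]⟩
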